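/- arXiv:math/0601687 — 2 statements merged into one kernel-verified Lean document; each statement's English description precedes it below -/
import Mathlib

section
/- (Stanley) Attach to each maximal chain σ_0 ⋖ σ_1 ⋖ ⋯ ⋖ σ_n of NC_{n+1} the label sequence (λ_1, …, λ_n), where if σ_i is obtained from σ_{i−1} by merging blocks B and B' with min B < min B', then λ_i is the largest element of B that is less than every element of B'. This map is a bijection from the set of maximal chains of NC_{n+1} onto the set of parking functions of length n; in particular, every parking function of length n occurs as the label sequence of exactly one maximal chain. -/
/-- A partition of `[n]` (encoded as an equivalence relation / setoid on `Fin n`)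
is *noncrossing* if there are no elements `a < b < c < d` with `a` and `c` in one
block and `b` and `d` in a different block. -/
def IsNoncrossing {n : ℕ} (σ : Setoid (Fin n)) : Prop :=
  ∀ a b c d : Fin n, a < b → b < c → c < d → σ a c → σ b d → σ a b

/-- The noncrossing partition lattice `NC_n`, ordered by refinement. -/
abbrev NC (n : ℕ) := {σ : Setoid (Fin n) // IsNoncrossing σ}

/-- The discrete partition (every block a singleton), as an element of `NC_n`. -/
def discNC (n : ℕ) : NC n :=
  ⟨⟨Eq, eq_equivalence⟩, by
    intro a b c d hab hbc hcd hac _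
    exact absurd hac (ne_of_lt (hab.trans hbc))⟩

/-- The partition with a single block, as an element of `NC_n`. -/
def fullNC (n : ℕ) : NC n :=
  ⟨⟨fun _ _ => True, ⟨fun _ => trivial, fun _ => trivial, fun _ _ => trivial⟩⟩,
    fun _ _ _ _ _ _ _ _ _ => trivial⟩

/-- A maximal chain of `NC_{n+1}`, presented as a saturated chain
`σ_0 ⋖ σ_1 ⋖ ⋯ ⋖ σ_n` from the discrete partition to the one-block partition. -/
def IsMaxChainFun (n : ℕ) (c : ℕ → NC (n + 1)) : Prop :=
  c 0 = discNC (n + 1) ∧ c n = fullNC (n + 1) ∧ ∀ i < n, c i ⋖ c (i + 1)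

/-- `lam` is the Stanley label of the covering step from `σ` to `τ`: `τ` is obtained
from `σ` by merging two blocks `B` and `B'` with `min B < min B'`, and `lam` is the
largest element of `B` that is less than every element of `B'`.  (Elements of
`Fin m` are `0`-based, so the `1`-based label is `m.val + 1`.) -/
def IsStanleyLabel {m : ℕ} (σ τ : Setoid (Fin m)) (lam : ℕ) : Prop :=
  ∃ B B' : Set (Fin m), B ∈ σ.classes ∧ B' ∈ σ.classes ∧ B ≠ B' ∧
    (B ∪ B') ∈ τ.classes ∧
    (∀ A ∈ σ.classes, A ≠ B → A ≠ B' → A ∈ τ.classes) ∧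
    ∃ b ∈ B, (∀ y ∈ B', b < y) ∧ (∀ a ∈ B, (∀ y ∈ B', a < y) → a ≤ b) ∧
      lam = (b : ℕ) + 1

/-- A parking function of length `n`: a sequence of elements of `[n] = {1, …, n}`
whose nondecreasing rearrangement `b_1 ≤ ⋯ ≤ b_n` satisfies `b_i ≤ i` for all `i`. -/
def IsParkingFunction (n : ℕ) (a : Fin n → ℕ) : Prop :=
  (∀ i, a i ∈ Finset.Icc 1 n) ∧
  ∃ e : Equiv.Perm (Fin n), (Monotone fun i => a (e i)) ∧
    ∀ i : Fin n, a (e i) ≤ (i : ℕ) + 1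

/-- relative parking condition of weights `w` on the block `C` -/
def Park {m : ℕ} (w : Fin m → ℕ) (C : Finset (Fin m)) : Prop :=
  ∑ x ∈ C, w x + 1 = C.card ∧
    ∀ t : ℕ, ∑ x ∈ C.filter (fun x => t ≤ x.val), w x ≤ (C.filter (fun x => t < x.val)).card

/-- add one label -/
def bump {m : ℕ} (w : Fin m → ℕ) (b : Fin m) : Fin m → ℕ :=
  fun x => w x + if x = b then 1 else 0

lemma sum_filter_split {m : ℕ} (f : Fin m → ℕ) (C : Finset (Fin m)) (p q r : Fin m → Prop)
    [DecidablePred p] [DecidablePred q] [DecidablePred r]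
    (h : ∀ x ∈ C, (p x ↔ q x ∨ r x) ∧ ¬ (q x ∧ r x)) :
    ∑ x ∈ C.filter p, f x = ∑ x ∈ C.filter q, f x + ∑ x ∈ C.filter r, f x := by
  rw [Finset.sum_filter, Finset.sum_filter, Finset.sum_filter, ← Finset.sum_add_distrib]
  apply Finset.sum_congr rfl
  intro x hx
  have := h x hx
  grind

lemma card_filter_split {m : ℕ} (C : Finset (Fin m)) (p q r : Fin m → Prop)
    [DecidablePred p] [DecidablePred q] [DecidablePred r]
    (h : ∀ x ∈ C, (p x ↔ q x ∨ r x) ∧ ¬ (q x ∧ r x)) :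
    (C.filter p).card = (C.filter q).card + (C.filter r).card := by
  have := sum_filter_split (fun _ => 1) C p q r h
  simpa using this

lemma bump_sum {m : ℕ} (w : Fin m → ℕ) (b : Fin m) (C : Finset (Fin m)) :
    ∑ x ∈ C, bump w b x = ∑ x ∈ C, w x + if b ∈ C then 1 else 0 := by
  simp [bump, Finset.sum_add_distrib]

lemma Park.congr_bump {m : ℕ} {w : Fin m → ℕ} {b : Fin m} {C : Finset (Fin m)} (hb : b ∉ C) :
    Park (bump w b) C ↔ Park w C := by
  unfold Park
  simp [bump_sum, hb]

lemma Park.up {m : ℕ} {w : Fin m → ℕ} {b : Fin m} {C : Finset (Fin m)} (p : Fin m → Prop)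
    [DecidablePred p] (hb : b ∈ C) (hlt : ∀ x ∈ C, p x → b < x)
    (h1 : Park w (C.filter p)) (h2 : Park w (C.filter (fun x => ¬ p x))) :
    Park (bump w b) C := by
  obtain ⟨h1a, h1b⟩ := h1
  obtain ⟨h2a, h2b⟩ := h2
  have e1 : ∑ x ∈ C.filter p, w x + ∑ x ∈ C.filter (fun x => ¬ p x), w x = ∑ x ∈ C, w x :=
    Finset.sum_filter_add_sum_filter_not C p w
  have e2 : (C.filter p).card + (C.filter (fun x => ¬ p x)).card = C.card :=
    Finset.card_filter_add_card_filter_not (s := C) p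
  refine ⟨?_, fun t => ?_⟩
  · rw [bump_sum, if_pos hb]; omega
  · have h1t := h1b t
    have h2t := h2b t
    simp only [Finset.filter_filter] at h1t h2t
    have a1 := sum_filter_split w C (fun x => t ≤ x.val) (fun x => p x ∧ t ≤ x.val)
      (fun x => ¬ p x ∧ t ≤ x.val) (by grind)
    have a2 := card_filter_split C (fun x => t < x.val) (fun x => p x ∧ t < x.val)
      (fun x => ¬ p x ∧ t < x.val) (by grind)
    rw [bump_sum]
    by_cases ht : t ≤ b.val
    · have a3 : C.filter (fun x => p x ∧ t ≤ x.val) = C.filter p := by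
        apply Finset.filter_congr
        intro x hx
        have := hlt x hx
        constructor
        · exact fun h => h.1
        · intro h; have := this h; exact ⟨h, by rw [Fin.lt_def] at this; omega⟩
      have a4 : C.filter (fun x => p x ∧ t < x.val) = C.filter p := by
        apply Finset.filter_congr
        intro x hx
        have := hlt x hx
        constructor
        · exact fun h => h.1
        · intro h; have := this h; exact ⟨h, by rw [Fin.lt_def] at this; omega⟩
      rw [a3] at a1
      rw [a4] at a2
      split_ifs <;> omega
    · rw [if_neg (by simp [ht])]
      omega

lemma card_filter_le_succ {m : ℕ} (C : Finset (Fin m)) (p q : Fin m → Prop)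
    [DecidablePred p] [DecidablePred q] (y : ℕ)
    (h : ∀ x ∈ C, p x → q x ∨ x.val = y) :
    (C.filter p).card ≤ (C.filter q).card + 1 := by
  have h1 : C.filter p ⊆ C.filter q ∪ Finset.univ.filter (fun x : Fin m => x.val = y) := by
    intro x hx
    have := h x
    grind
  have h2 : (Finset.univ.filter (fun x : Fin m => x.val = y)).card ≤ 1 := by
    rw [Finset.card_le_one]
    intro a ha b hb
    simp at ha hb
    exact Fin.ext (by omega)
  calc _ ≤ _ := Finset.card_le_card h1
    _ ≤ _ := Finset.card_union_le _ _
    _ ≤ _ := by omega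

lemma Park.down {m : ℕ} {w : Fin m → ℕ} {b : Fin m} {C : Finset (Fin m)}
    (hb : b ∈ C) (h : Park (bump w b) C) :
    ∃ y ∈ C, b < y ∧ Park w (C.filter (fun x => b < x ∧ x ≤ y)) ∧
      Park w (C.filter (fun x => ¬ (b < x ∧ x ≤ y))) := by
  obtain ⟨ha, hc⟩ := h
  simp only [bump_sum, hb, if_true] at ha
  have hc' : ∀ t : ℕ, ∑ x ∈ C.filter (fun x => t ≤ x.val), w x + (if t ≤ b.val then 1 else 0) ≤
      (C.filter (fun x => t < x.val)).card := by
    intro t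
    have := hc t
    rw [bump_sum] at this
    simpa [hb] using this
  clear hc
  -- minimal y
  have hex : ∃ y : ℕ, ∑ x ∈ C.filter (fun x => b.val < x.val ∧ x.val ≤ y), w x <
      (C.filter (fun x => b.val < x.val ∧ x.val ≤ y)).card := by
    refine ⟨m, ?_⟩
    have h1 := hc' b.val
    rw [if_pos le_rfl] at h1
    have e : C.filter (fun x => b.val < x.val ∧ x.val ≤ m) = C.filter (fun x => b.val < x.val) := by
      apply Finset.filter_congr
      intro x _
      have := x.isLt
      omega
    rw [e]
    have h2 : ∑ x ∈ C.filter (fun x => b.val < x.val), w x ≤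
        ∑ x ∈ C.filter (fun x => b.val ≤ x.val), w x := by
      apply Finset.sum_le_sum_of_subset
      intro x
      simp only [Finset.mem_filter]
      rintro ⟨h, h'⟩
      exact ⟨h, h'.le⟩
    omega
  set y := Nat.find hex with hy
  have hy1 := Nat.find_spec hex
  rw [← hy] at hy1
  have hy2 : ∀ z < y, (C.filter (fun x => b.val < x.val ∧ x.val ≤ z)).card ≤
      ∑ x ∈ C.filter (fun x => b.val < x.val ∧ x.val ≤ z), w x := by
    intro z hz
    exact not_lt.mp (Nat.find_min hex hz)
  have hby : b.val < y := by
    by_contra hcon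
    have : C.filter (fun x => b.val < x.val ∧ x.val ≤ y) = ∅ := by
      apply Finset.filter_eq_empty_iff.mpr
      intro x _
      omega
    rw [this] at hy1
    simp at hy1
  have hyC : ∃ z ∈ C, z.val = y := by
    by_contra hcon
    push Not at hcon
    have := hy2 (y-1) (by omega)
    have e : C.filter (fun x => b.val < x.val ∧ x.val ≤ y) =
      C.filter (fun x => b.val < x.val ∧ x.val ≤ y - 1) := by
      apply Finset.filter_congr
      intro x hx
      have := hcon x hx
      omega
    rw [e] at hy1
    omega
  clear_value y
  obtain ⟨z, hzC, rfl⟩ := hyC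
  have tot : ∑ x ∈ C.filter (fun x => b.val < x.val ∧ x.val ≤ z.val), w x + 1 =
      (C.filter (fun x => b.val < x.val ∧ x.val ≤ z.val)).card := by
    have h1 := hy2 (z.val-1) (by omega)
    have h2 := card_filter_le_succ C (fun x => b.val < x.val ∧ x.val ≤ z.val)
      (fun x => b.val < x.val ∧ x.val ≤ z.val - 1) z.val (by intro x _ hx; omega)
    have h3 : ∑ x ∈ C.filter (fun x => b.val < x.val ∧ x.val ≤ z.val - 1), w x ≤
        ∑ x ∈ C.filter (fun x => b.val < x.val ∧ x.val ≤ z.val), w x := by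
      apply Finset.sum_le_sum_of_subset
      intro x
      simp only [Finset.mem_filter]
      rintro ⟨h, h'⟩
      exact ⟨h, by omega⟩
    omega
  refine ⟨z, hzC, hby, ?_, ?_⟩
  · simp only [Fin.lt_def, Fin.le_def]
    refine ⟨tot, fun t => ?_⟩
    simp only [Finset.filter_filter]
    by_cases ht : t ≤ b.val
    · have e1 : C.filter (fun x => (b.val < x.val ∧ x.val ≤ z.val) ∧ t ≤ x.val) =
        C.filter (fun x => b.val < x.val ∧ x.val ≤ z.val) := by
        apply Finset.filter_congr
        intro x _
        omega
      have e2 : C.filter (fun x => (b.val < x.val ∧ x.val ≤ z.val) ∧ t < x.val) =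
        C.filter (fun x => b.val < x.val ∧ x.val ≤ z.val) := by
        apply Finset.filter_congr
        intro x _
        omega
      rw [e1, e2]; omega
    · by_cases ht2 : t ≤ z.val
      · have h1 := hy2 (t-1) (by omega)
        have h2 := sum_filter_split w C (fun x => b.val < x.val ∧ x.val ≤ z.val)
          (fun x => b.val < x.val ∧ x.val ≤ t - 1)
          (fun x => (b.val < x.val ∧ x.val ≤ z.val) ∧ t ≤ x.val) (by intro x _; omega)
        have h3 := card_filter_split C (fun x => b.val < x.val ∧ x.val ≤ z.val)
          (fun x => b.val < x.val ∧ x.val ≤ t - 1)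
          (fun x => (b.val < x.val ∧ x.val ≤ z.val) ∧ t ≤ x.val) (by intro x _; omega)
        have h4 := card_filter_le_succ C (fun x => (b.val < x.val ∧ x.val ≤ z.val) ∧ t ≤ x.val)
          (fun x => (b.val < x.val ∧ x.val ≤ z.val) ∧ t < x.val) t (by intro x _ hx; omega)
        omega
      · have e1 : C.filter (fun x => (b.val < x.val ∧ x.val ≤ z.val) ∧ t ≤ x.val) = ∅ := by
          apply Finset.filter_eq_empty_iff.mpr
          intro x _
          omega
        rw [e1]; simp
  · simp only [Fin.lt_def, Fin.le_def]
    have s1 := Finset.sum_filter_add_sum_filter_not C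
      (fun x => b.val < x.val ∧ x.val ≤ z.val) w
    have s2 := Finset.card_filter_add_card_filter_not (s := C)
      (fun x => b.val < x.val ∧ x.val ≤ z.val)
    refine ⟨by omega, ?_⟩
    have big : ∀ t : ℕ, z.val < t → ∑ x ∈ C.filter
        (fun x => (¬ (b.val < x.val ∧ x.val ≤ z.val)) ∧ t ≤ x.val), w x ≤
        (C.filter (fun x => (¬ (b.val < x.val ∧ x.val ≤ z.val)) ∧ t < x.val)).card := by
      intro t ht
      have e1 : C.filter (fun x => (¬ (b.val < x.val ∧ x.val ≤ z.val)) ∧ t ≤ x.val) =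
          C.filter (fun x => t ≤ x.val) := by
        apply Finset.filter_congr
        intro x _
        omega
      have e2 : C.filter (fun x => (¬ (b.val < x.val ∧ x.val ≤ z.val)) ∧ t < x.val) =
          C.filter (fun x => t < x.val) := by
        apply Finset.filter_congr
        intro x _
        omega
      rw [e1, e2]
      have := hc' t
      omega
    intro t
    simp only [Finset.filter_filter]
    by_cases ht : t ≤ b.val
    · have h1 := hc' t
      rw [if_pos ht] at h1
      have h2 := sum_filter_split w C (fun x => t ≤ x.val)
        (fun x => b.val < x.val ∧ x.val ≤ z.val)
        (fun x => (¬ (b.val < x.val ∧ x.val ≤ z.val)) ∧ t ≤ x.val) (by intro x _; omega)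
      have h3 := card_filter_split C (fun x => t < x.val)
        (fun x => b.val < x.val ∧ x.val ≤ z.val)
        (fun x => (¬ (b.val < x.val ∧ x.val ≤ z.val)) ∧ t < x.val) (by intro x _; omega)
      omega
    · by_cases ht2 : t ≤ z.val
      · have h1 := big (z.val + 1) (by omega)
        have e1 : C.filter (fun x => (¬ (b.val < x.val ∧ x.val ≤ z.val)) ∧ t ≤ x.val) =
          C.filter (fun x => (¬ (b.val < x.val ∧ x.val ≤ z.val)) ∧ z.val + 1 ≤ x.val) := by
          apply Finset.filter_congr
          intro x _
          omega
        rw [e1]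
        refine h1.trans (Finset.card_le_card ?_)
        intro x
        simp only [Finset.mem_filter]
        rintro ⟨h, h', h''⟩
        exact ⟨h, h', by omega⟩
      · exact big t (by omega)

lemma Park.unique_aux {m : ℕ} {w : Fin m → ℕ} {b y z : Fin m} {C : Finset (Fin m)}
    (hz : z ∈ C) (hb : b < y)
    (h1 : Park w (C.filter (fun x => b < x ∧ x ≤ y)))
    (h2 : Park w (C.filter (fun x => b < x ∧ x ≤ z))) (hyz : y < z) : False := by
  -- successor of y in C
  have hex : ∃ t : ℕ, ∃ u ∈ C, u.val = t ∧ y < u := ⟨z.val, z, hz, rfl, hyz⟩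
  obtain ⟨u, huC, hut, hyu⟩ := Nat.find_spec hex
  have hmin : ∀ x ∈ C, y < x → u ≤ x := by
    intro x hx hyx
    have := Nat.find_min' hex ⟨x, hx, rfl, hyx⟩
    rw [Fin.le_def]; omega
  have huz := hmin z hz hyz
  have k1 := h1.1
  have k2 := h2.1
  have k3 := h2.2 u.val
  simp only [Finset.filter_filter] at k3
  have a1 := sum_filter_split w C (fun x => b < x ∧ x ≤ z) (fun x => b < x ∧ x ≤ y)
    (fun x => (b < x ∧ x ≤ z) ∧ u.val ≤ x.val) (by
      intro x hx; have := hmin x hx; simp only [Fin.lt_def, Fin.le_def] at *; omega)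
  have a2 := card_filter_split C (fun x => b < x ∧ x ≤ z) (fun x => b < x ∧ x ≤ y)
    (fun x => (b < x ∧ x ≤ z) ∧ u.val ≤ x.val) (by
      intro x hx; have := hmin x hx; simp only [Fin.lt_def, Fin.le_def] at *; omega)
  have a3 := card_filter_split C (fun x => (b < x ∧ x ≤ z) ∧ u.val ≤ x.val)
    (fun x => (b < x ∧ x ≤ z) ∧ u.val < x.val) (fun x => x = u) (by
      intro x hx; simp only [Fin.lt_def, Fin.le_def, Fin.ext_iff] at *; omega)
  have a4 : (C.filter (fun x => x = u)).card = 1 := by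
    rw [Finset.filter_eq', if_pos huC]; simp
  omega

lemma Park.unique {m : ℕ} {w : Fin m → ℕ} {b y z : Fin m} {C : Finset (Fin m)}
    (hy : y ∈ C) (hz : z ∈ C) (hb : b < y) (hb' : b < z)
    (h1 : Park w (C.filter (fun x => b < x ∧ x ≤ y)))
    (h2 : Park w (C.filter (fun x => b < x ∧ x ≤ z))) : y = z := by
  rcases lt_trichotomy y z with h | h | h
  · exact (Park.unique_aux hz hb h1 h2 h).elim
  · exact h
  · exact (Park.unique_aux hy hb' h2 h1 h).elim

open Classical in
/-- block of `x` -/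
noncomputable def cls {m : ℕ} (σ : Setoid (Fin m)) (x : Fin m) : Finset (Fin m) :=
  Finset.univ.filter (fun y => σ x y)

lemma mem_cls {m : ℕ} {σ : Setoid (Fin m)} {x y : Fin m} : y ∈ cls σ x ↔ σ x y := by
  simp [cls]

lemma cls_eq {m : ℕ} {σ : Setoid (Fin m)} {x y : Fin m} (h : σ x y) : cls σ x = cls σ y := by
  ext z
  rw [mem_cls, mem_cls]
  exact ⟨fun k => σ.trans' (σ.symm' h) k, fun k => σ.trans' h k⟩

/-- all blocks satisfy the parking condition -/
def PS {m : ℕ} (w : Fin m → ℕ) (σ : Setoid (Fin m)) : Prop := ∀ x, Park w (cls σ x)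

/-- `σ` arises from `τ` by splitting off the elements of the block of `b` in `(b, y]` -/
def Split {m : ℕ} (σ τ : Setoid (Fin m)) (b y : Fin m) : Prop :=
  b < y ∧ τ b y ∧ ∀ x z, σ x z ↔ τ x z ∧ ((τ b x ∧ b < x ∧ x ≤ y) ↔ (τ b z ∧ b < z ∧ z ≤ y))

lemma Split.cls_out {m : ℕ} {σ τ : Setoid (Fin m)} {b y x : Fin m} (h : Split σ τ b y)
    (hx : ¬ τ b x) : cls σ x = cls τ x := by
  ext z
  rw [mem_cls, mem_cls, h.2.2]
  constructor
  · exact fun k => k.1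
  · intro k
    have : ¬ τ b z := fun l => hx (τ.trans' l (τ.symm' k))
    tauto

lemma Split.cls_in {m : ℕ} {σ τ : Setoid (Fin m)} {b y x : Fin m} (h : Split σ τ b y)
    (hx : τ b x) (hx' : b < x ∧ x ≤ y) :
    cls σ x = (cls τ b).filter (fun x => b < x ∧ x ≤ y) := by
  ext z
  rw [Finset.mem_filter, mem_cls, mem_cls, h.2.2]
  constructor
  · intro k; have := k.2.1 ⟨hx, hx'⟩; exact this
  · intro k; exact ⟨τ.trans' (τ.symm' hx) k.1, by tauto⟩

lemma Split.cls_in' {m : ℕ} {σ τ : Setoid (Fin m)} {b y x : Fin m} (h : Split σ τ b y)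
    (hx : τ b x) (hx' : ¬ (b < x ∧ x ≤ y)) :
    cls σ x = (cls τ b).filter (fun x => ¬ (b < x ∧ x ≤ y)) := by
  ext z
  rw [Finset.mem_filter, mem_cls, mem_cls, h.2.2]
  constructor
  · intro k; have := τ.trans' hx k.1; tauto
  · intro k; exact ⟨τ.trans' (τ.symm' hx) k.1, by tauto⟩

lemma Split.up {m : ℕ} {σ τ : Setoid (Fin m)} {b y : Fin m} {w : Fin m → ℕ} (h : Split σ τ b y)
    (hp : PS w σ) : PS (bump w b) τ := by
  intro x
  by_cases hx : τ b x
  · rw [← cls_eq hx]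
    apply Park.up (fun x => b < x ∧ x ≤ y) (mem_cls.2 (τ.refl' b)) (fun x _ hx => hx.1)
    · rw [← h.cls_in h.2.1 ⟨h.1, le_rfl⟩]; exact hp y
    · rw [← h.cls_in' (τ.refl' b) (by simp)]; exact hp b
  · rw [Park.congr_bump, ← h.cls_out hx]
    · exact hp x
    · rw [mem_cls]; exact fun k => hx (τ.symm' k)

lemma Split.unique {m : ℕ} {σ σ' τ : Setoid (Fin m)} {b y y' : Fin m} {w : Fin m → ℕ}
    (h : Split σ τ b y) (h' : Split σ' τ b y') (hp : PS w σ) (hp' : PS w σ') : σ = σ' := by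
  have e : y = y' := by
    apply Park.unique (w := w) (mem_cls.2 h.2.1) (mem_cls.2 h'.2.1) h.1 h'.1
    · rw [← h.cls_in h.2.1 ⟨h.1, le_rfl⟩]; exact hp y
    · rw [← h'.cls_in h'.2.1 ⟨h'.1, le_rfl⟩]; exact hp' y'
  subst e
  ext x z
  exact (h.2.2 x z).trans (h'.2.2 x z).symm

/-- the split of `τ` -/
def splitS {m : ℕ} (τ : Setoid (Fin m)) (b y : Fin m) : Setoid (Fin m) where
  r x z := τ x z ∧ ((τ b x ∧ b < x ∧ x ≤ y) ↔ (τ b z ∧ b < z ∧ z ≤ y))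
  iseqv := ⟨fun x => ⟨τ.refl' x, Iff.rfl⟩, fun h => ⟨τ.symm' h.1, h.2.symm⟩,
    fun h k => ⟨τ.trans' h.1 k.1, h.2.trans k.2⟩⟩

lemma Split.noncrossing {m : ℕ} {σ τ : Setoid (Fin m)} {b y : Fin m}
    (h : Split σ τ b y) (hn : IsNoncrossing τ) : IsNoncrossing σ := by
  intro p q r s hpq hqr hrs hpr hqs
  rw [h.2.2] at *
  have h1 := hn p q r s hpq hqr hrs hpr.1 hqs.1
  refine ⟨h1, ?_⟩
  have h2 := hpr.2
  have h3 := hqs.2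
  by_cases hb : τ b p
  · have b1 := τ.trans' hb h1
    have b2 := τ.trans' hb hpr.1
    have b3 := τ.trans' b1 hqs.1
    simp only [hb, b1, b2, b3, true_and, Fin.lt_def, Fin.le_def] at *
    omega
  · have b1 : ¬ τ b q := fun k => hb (τ.trans' k (τ.symm' h1))
    tauto

lemma PS.down {m : ℕ} {τ : Setoid (Fin m)} {b : Fin m} {w : Fin m → ℕ}
    (hp : PS (bump w b) τ) : ∃ σ y, Split σ τ b y ∧ PS w σ := by
  obtain ⟨y, hyC, hby, h1, h2⟩ := Park.down (mem_cls.2 (τ.refl' b)) (hp b)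
  have hs : Split (splitS τ b y) τ b y := ⟨hby, mem_cls.1 hyC, fun _ _ => Iff.rfl⟩
  refine ⟨splitS τ b y, y, hs, fun x => ?_⟩
  by_cases hx : τ b x
  · by_cases hx' : b < x ∧ x ≤ y
    · rw [hs.cls_in hx hx']; exact h1
    · rw [hs.cls_in' hx hx']; exact h2
  · rw [hs.cls_out hx, ← Park.congr_bump (b := b)]
    · exact hp x
    · rw [mem_cls]; exact fun k => hx (τ.symm' k)

lemma Split.covBy {m : ℕ} {σ τ : NC m} {b y : Fin m}
    (h : Split σ.val τ.val b y) : σ ⋖ τ := by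
  have hle : σ.val ≤ τ.val := fun {x z} k => ((h.2.2 x z).1 k).1
  have hby : ¬ σ.val b y := by
    intro k
    have := ((h.2.2 b y).1 k).2.2 ⟨h.2.1, h.1, le_rfl⟩
    exact lt_irrefl _ this.2.1
  refine ⟨lt_of_le_of_ne hle ?_, ?_⟩
  · intro e
    apply hby
    rw [e]
    exact h.2.1
  · intro ρ h1 h2
    have h1' : σ.val ≤ ρ.val := h1.le
    have h2' : ρ.val ≤ τ.val := h2.le
    apply h2.not_ge
    have key : ∃ x z, ρ.val x z ∧ ¬ σ.val x z := by
      by_contra hcon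
      push Not at hcon
      exact h1.not_ge (fun {x z} k => hcon x z k)
    obtain ⟨x, z, hxz, hn⟩ := key
    have hby' : ρ.val b y := by
      have ht := h2' hxz
      rw [h.2.2] at hn
      have hn' : ¬ ((τ.val b x ∧ b < x ∧ x ≤ y) ↔ (τ.val b z ∧ b < z ∧ z ≤ y)) :=
        fun k => hn ⟨ht, k⟩
      have hbx : τ.val b x := by
        by_contra hbx
        have : ¬ τ.val b z := fun k => hbx (τ.val.trans' k (τ.val.symm' ht))
        tauto
      have hbz : τ.val b z := τ.val.trans' hbx ht
      by_cases hx' : b < x ∧ x ≤ y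
      · have hz' : ¬ (b < z ∧ z ≤ y) := by tauto
        have k1 : σ.val b z := (h.2.2 b z).2 ⟨hbz, by have := lt_irrefl b; tauto⟩
        have k2 : σ.val x y := (h.2.2 x y).2
          ⟨τ.val.trans' (τ.val.symm' hbx) h.2.1, by have := h.2.1; have := h.1; simp; tauto⟩
        exact ρ.val.trans' (h1' k1) (ρ.val.trans' (ρ.val.symm' hxz) (h1' k2))
      · have hz' : (b < z ∧ z ≤ y) := by tauto
        have k1 : σ.val b x := (h.2.2 b x).2 ⟨hbx, by have := lt_irrefl b; tauto⟩
        have k2 : σ.val z y := (h.2.2 z y).2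
          ⟨τ.val.trans' (τ.val.symm' hbz) h.2.1, by have := h.2.1; have := h.1; simp; tauto⟩
        exact ρ.val.trans' (h1' k1) (ρ.val.trans' hxz (h1' k2))
    show τ.val ≤ ρ.val
    intro u v huv
    by_cases hu : τ.val b u
    · have hv := τ.val.trans' hu huv
      have all : ∀ u, τ.val b u → ρ.val b u := by
        intro u hu
        by_cases hu' : b < u ∧ u ≤ y
        · have k : σ.val y u := (h.2.2 y u).2
            ⟨τ.val.trans' (τ.val.symm' h.2.1) hu, by have := h.2.1; have := h.1; simp; tauto⟩
          exact ρ.val.trans' hby' (h1' k)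
        · exact h1' ((h.2.2 b u).2 ⟨hu, by have := lt_irrefl b; tauto⟩)
      exact ρ.val.trans' (ρ.val.symm' (all u hu)) (all v hv)
    · apply h1'
      rw [h.2.2]
      refine ⟨huv, ?_⟩
      have : ¬ τ.val b v := fun k => hu (τ.val.trans' k (τ.val.symm' huv))
      tauto

lemma mem_classes_cls {m : ℕ} (σ : Setoid (Fin m)) (x : Fin m) :
    (cls σ x : Set (Fin m)) ∈ σ.classes := by
  refine ⟨x, ?_⟩
  ext z
  rw [Finset.mem_coe, mem_cls]
  exact ⟨fun h => σ.symm' h, fun h => σ.symm' h⟩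

lemma classes_eq {m : ℕ} {σ : Setoid (Fin m)} {A : Set (Fin m)} (hA : A ∈ σ.classes)
    {x : Fin m} (hx : x ∈ A) : A = cls σ x := by
  obtain ⟨y, rfl⟩ := hA
  have hx' : σ x y := hx
  ext z
  rw [Finset.mem_coe, mem_cls]
  exact ⟨fun h => σ.trans' hx' (σ.symm' h), fun h => σ.trans' (σ.symm' h) hx'⟩

lemma Split.label {m : ℕ} {σ τ : Setoid (Fin m)} {b y : Fin m}
    (h : Split σ τ b y) : IsStanleyLabel σ τ (b.val + 1) := by
  have eb := h.cls_in' (τ.refl' b) (by simp)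
  have ey := h.cls_in h.2.1 ⟨h.1, le_rfl⟩
  have hb : b ∈ cls σ b := mem_cls.2 (σ.refl' b)
  have hy : y ∈ cls σ y := mem_cls.2 (σ.refl' y)
  have hu : (cls σ b : Set (Fin m)) ∪ cls σ y = cls τ b := by
    rw [eb, ey, ← Finset.coe_union, Finset.union_comm, Finset.filter_union_filter_not_eq]
  refine ⟨cls σ b, cls σ y, mem_classes_cls _ _, mem_classes_cls _ _, ?_, ?_, ?_, b, hb,
    ?_, ?_, rfl⟩
  · intro e
    rw [Finset.coe_inj] at e
    rw [e, ey] at hb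
    simp at hb
  · rw [hu]; exact mem_classes_cls _ _
  · intro A hA h1 h2
    obtain ⟨x, hx⟩ : A.Nonempty := by
      obtain ⟨y, rfl⟩ := hA
      exact ⟨y, σ.refl' y⟩
    have e := classes_eq hA hx
    subst e
    by_cases hbx : τ b x
    · exfalso
      by_cases hx' : b < x ∧ x ≤ y
      · exact h2 (by rw [h.cls_in hbx hx', ey])
      · exact h1 (by rw [h.cls_in' hbx hx', eb])
    · rw [h.cls_out hbx]; exact mem_classes_cls _ _
  · intro z hz
    rw [ey] at hz
    simp at hz
    exact hz.2.1
  · intro a ha hlt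
    rw [eb] at ha
    have h1 := hlt y hy
    simp only [Finset.coe_filter, Set.mem_ofPred_eq] at ha
    by_contra hcon
    exact ha.2 ⟨not_le.1 hcon, h1.le⟩

lemma label_split {m : ℕ} {σ τ : Setoid (Fin m)} {lam : ℕ} (hn : IsNoncrossing σ)
    (h : IsStanleyLabel σ τ lam) : ∃ b y : Fin m, lam = b.val + 1 ∧ Split σ τ b y := by
  obtain ⟨B, B', hB, hB', hne, hU, hA, b, hb, hlt, hmax, rfl⟩ := h
  have hne' : B'.Nonempty := by
    obtain ⟨y, rfl⟩ := hB'
    exact ⟨y, σ.refl' y⟩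
  obtain ⟨y, hy, hymax⟩ := Set.exists_max_image B' id (Set.toFinite _) hne'
  have e1 := classes_eq hB hb
  have e2 := classes_eq hB' hy
  have eU := classes_eq hU (Set.mem_union_left _ hb)
  have m1 : ∀ z, z ∈ B ↔ σ b z := fun z => by rw [e1, Finset.mem_coe, mem_cls]
  have m2 : ∀ z, z ∈ B' ↔ σ y z := fun z => by rw [e2, Finset.mem_coe, mem_cls]
  have mU : ∀ z, (z ∈ B ∨ z ∈ B') ↔ τ b z := fun z => by
    rw [← Set.mem_union, eU, Finset.mem_coe, mem_cls]
  have disj : ∀ z, z ∈ B → z ∈ B' → False := by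
    intro z h1 h2
    exact hne ((classes_eq hB h1).trans (classes_eq hB' h2).symm)
  have key : ∀ z, (τ b z ∧ b < z ∧ z ≤ y) ↔ z ∈ B' := by
    intro z
    constructor
    · rintro ⟨h1, h2, h3⟩
      rcases (mU z).2 h1 with hz | hz
      · exfalso
        have : ¬ ∀ y ∈ B', z < y := fun k => absurd (hmax z hz k) (not_le.2 h2)
        push Not at this
        obtain ⟨y0, hy0, hle⟩ := this
        have n1 : y0 < z := lt_of_le_of_ne hle (fun e => disj z hz (e ▸ hy0))
        have n2 : z < y := lt_of_le_of_ne h3 (fun e => disj z hz (e ▸ hy))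
        have := hn b y0 z y (hlt y0 hy0) n1 n2 ((m1 z).1 hz) (σ.symm' ((m2 y0).1 hy0))
        exact disj y0 ((m1 y0).2 this) hy0
      · exact hz
    · intro hz
      exact ⟨(mU z).1 (Or.inr hz), hlt z hz, hymax z hz⟩
  refine ⟨b, y, rfl, hlt y hy, (mU y).1 (Or.inr hy), fun x z => ?_⟩
  rw [key, key]
  by_cases hx : τ b x
  · rcases (mU x).2 hx with hxB | hxB
    · have hn' : x ∉ B' := fun k => disj x hxB k
      have hx1 := (m1 x).1 hxB
      constructor
      · intro k
        have hz : z ∈ B := (m1 z).2 (σ.trans' hx1 k)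
        have hz' : z ∉ B' := fun k => disj z hz k
        exact ⟨τ.trans' (τ.symm' hx) ((mU z).1 (Or.inl hz)), by tauto⟩
      · rintro ⟨k1, k2⟩
        have := (mU z).2 (τ.trans' hx k1)
        have hz : z ∈ B := by tauto
        exact σ.trans' (σ.symm' hx1) ((m1 z).1 hz)
    · have hx1 := (m2 x).1 hxB
      constructor
      · intro k
        have hz : z ∈ B' := (m2 z).2 (σ.trans' hx1 k)
        exact ⟨τ.trans' (τ.symm' hx) ((mU z).1 (Or.inr hz)), by tauto⟩
      · rintro ⟨k1, k2⟩
        have hz : z ∈ B' := by tauto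
        exact σ.trans' (σ.symm' hx1) ((m2 z).1 hz)
  · have hx1 : x ∉ B := fun k => hx ((mU x).1 (Or.inl k))
    have hx2 : x ∉ B' := fun k => hx ((mU x).1 (Or.inr k))
    have hxs : x ∈ (cls σ x : Set (Fin m)) := by rw [Finset.mem_coe, mem_cls]
    have hc := hA _ (mem_classes_cls σ x) (fun e => hx1 (e ▸ hxs)) (fun e => hx2 (e ▸ hxs))
    have e := classes_eq hc hxs
    have e' : σ x z ↔ τ x z := by
      rw [← mem_cls, ← mem_cls, ← Finset.mem_coe, e, Finset.mem_coe]
    rw [e']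
    constructor
    · intro k
      have hz : z ∉ B' := fun l => hx (τ.trans' ((mU z).1 (Or.inr l)) (τ.symm' k))
      exact ⟨k, by tauto⟩
    · exact fun k => k.1

/-- weights of the first `i` labels -/
def wt {n : ℕ} (lam : Fin n → ℕ) (i : ℕ) : Fin (n + 1) → ℕ :=
  fun x => (Finset.univ.filter (fun k : Fin n => k.val < i ∧ lam k = x.val + 1)).card

lemma wt_succ {n : ℕ} (lam : Fin n → ℕ) (i : Fin n) (b : Fin (n + 1)) (hb : lam i = b.val + 1) :
    wt lam (i.val + 1) = bump (wt lam i.val) b := by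
  funext x
  unfold wt bump
  have h1 : (Finset.univ.filter (fun k : Fin n => k.val < i.val + 1 ∧ lam k = x.val + 1)) =
    (Finset.univ.filter (fun k : Fin n => k.val < i.val ∧ lam k = x.val + 1)) ∪
     (if x = b then {i} else ∅) := by
    ext k
    by_cases hx : x = b
    · subst hx
      simp only [Finset.mem_filter, Finset.mem_univ, true_and, if_true, Finset.mem_union,
        Finset.mem_singleton, Fin.ext_iff]
      constructor
      · intro h; omega
      · rintro (h | h)
        · omega
        · have : k = i := Fin.ext h
          subst this; omega
    · simp only [Finset.mem_filter, Finset.mem_univ, true_and, if_neg hx, Finset.mem_union,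
        Finset.notMem_empty, or_false]
      constructor
      · rintro ⟨h, h'⟩
        refine ⟨?_, h'⟩
        have : k.val ≠ i.val := by
          intro e
          have : k = i := Fin.ext e
          subst this
          exact hx (Fin.ext (by omega))
        omega
      · rintro ⟨h, h'⟩; exact ⟨by omega, h'⟩
  rw [h1, Finset.card_union_of_disjoint]
  · split_ifs <;> simp
  · split_ifs <;> simp

lemma PS_disc {n : ℕ} (lam : Fin n → ℕ) : PS (wt lam 0) (discNC (n + 1)).val := by
  intro x
  have e : cls (discNC (n + 1)).val x = {x} := by
    ext z
    rw [mem_cls, Finset.mem_singleton]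
    exact eq_comm
  rw [e]
  simp [Park, wt]

lemma eq_disc {n : ℕ} (lam : Fin n → ℕ) (σ : NC (n + 1)) (h : PS (wt lam 0) σ.val) :
    σ = discNC (n + 1) := by
  apply Subtype.ext
  ext x z
  have h1 := (h x).1
  have h2 : (cls σ.val x).card = 1 := by simpa [wt] using h1.symm
  rw [Finset.card_eq_one] at h2
  obtain ⟨a, ha⟩ := h2
  have hx : x ∈ cls σ.val x := mem_cls.2 (σ.val.refl' x)
  show σ.val x z ↔ x = z
  rw [← mem_cls]
  rw [ha] at hx ⊢
  simp at hx ⊢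
  subst hx
  exact eq_comm

lemma cls_full {n : ℕ} (x : Fin (n + 1)) : cls (fullNC (n + 1)).val x = Finset.univ := by
  ext z
  rw [mem_cls]
  simp only [Finset.mem_univ, iff_true]
  exact trivial

lemma wt_sum {n : ℕ} (lam : Fin n → ℕ) (hl : ∀ i, lam i ∈ Finset.Icc 1 n) (t : ℕ) :
    ∑ x ∈ Finset.univ.filter (fun x : Fin (n + 1) => t ≤ x.val), wt lam n x =
      (Finset.univ.filter (fun k : Fin n => t + 1 ≤ lam k)).card := by
  rw [Finset.card_eq_sum_card_fiberwise (f := fun k => (⟨lam k - 1, by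
      have := hl k; simp at this; omega⟩ : Fin (n + 1)))
      (t := Finset.univ.filter (fun x : Fin (n + 1) => t ≤ x.val))]
  · apply Finset.sum_congr rfl
    intro x hx
    unfold wt
    congr 1
    ext k
    have := hl k
    simp [Fin.ext_iff] at this hx ⊢
    omega
  · intro k hk
    simp at hk ⊢
    omega

lemma card_gt {n : ℕ} (t : ℕ) :
    (Finset.univ.filter (fun x : Fin (n + 1) => t < x.val)).card = n - t := by
  have : (Finset.univ.filter (fun x : Fin (n + 1) => t < x.val)).card = (Finset.Ioc t n).card := by
    apply Finset.card_bij (fun x _ => x.val)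
    · intro x hx; simp at hx ⊢; omega
    · intro x _ z _ h; exact Fin.ext h
    · intro z hz; simp at hz; exact ⟨⟨z, by omega⟩, by simpa using hz.1, rfl⟩
  rw [this]; simp

lemma PS_full_iff {n : ℕ} (lam : Fin n → ℕ) (hl : ∀ i, lam i ∈ Finset.Icc 1 n) :
    PS (wt lam n) (fullNC (n + 1)).val ↔
      ∀ t, (Finset.univ.filter (fun k : Fin n => t + 1 ≤ lam k)).card ≤ n - t := by
  have h0 := wt_sum lam hl 0
  have e : Finset.univ.filter (fun k : Fin n => 0 + 1 ≤ lam k) = Finset.univ := by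
    apply Finset.filter_true_of_mem
    intro k _
    have := hl k
    simp at this; omega
  rw [e] at h0
  simp at h0
  unfold PS Park
  simp only [cls_full, wt_sum lam hl, card_gt]
  simp [h0]

lemma parking_iff {n : ℕ} (lam : Fin n → ℕ) (hl : ∀ i, lam i ∈ Finset.Icc 1 n) :
    IsParkingFunction n lam ↔
      ∀ t, (Finset.univ.filter (fun k : Fin n => t + 1 ≤ lam k)).card ≤ n - t := by
  constructor
  · rintro ⟨-, e, -, he⟩ t
    have : (Finset.univ.filter (fun k : Fin n => t + 1 ≤ lam k)).card ≤ (Finset.Ico t n).card := by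
      apply Finset.card_le_card_of_injOn (fun k => (e.symm k).val)
      · intro k hk
        have := he (e.symm k)
        simp at hk this ⊢
        omega
      · intro a _ b _ h
        exact e.symm.injective (Fin.ext h)
    simpa using this
  · intro h
    refine ⟨hl, Tuple.sort lam, Tuple.monotone_sort lam, fun i => ?_⟩
    by_contra hcon
    have h1 := h (i.val + 1)
    have h2 : (Finset.Ici i).card ≤
        (Finset.univ.filter (fun k : Fin n => i.val + 1 + 1 ≤ lam k)).card := by
      apply Finset.card_le_card_of_injOn (Tuple.sort lam)
      · intro k hk
        have hk' : i ≤ k := by simpa using hk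
        have := Tuple.monotone_sort lam hk'
        simp at this ⊢
        omega
      · intro a _ b _ h
        exact (Tuple.sort lam).injective h
    rw [Fin.card_Ici] at h2
    have := i.isLt
    omega

lemma chain_PS {n : ℕ} (c : ℕ → NC (n + 1)) (hc : IsMaxChainFun n c) (lam : Fin n → ℕ)
    (hl : ∀ i : Fin n, IsStanleyLabel (c i).val (c ((i : ℕ) + 1)).val (lam i)) :
    ∀ i ≤ n, PS (wt lam i) (c i).val := by
  intro i
  induction i with
  | zero => intro _; rw [hc.1]; exact PS_disc lam
  | succ i ih =>
    intro hi
    obtain ⟨b, y, hb, hs⟩ := label_split (c i).prop (hl ⟨i, hi⟩)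
    have := wt_succ lam ⟨i, hi⟩ b hb
    simp only at this
    rw [this]
    exact hs.up (ih (by omega))

lemma exists_chain {n : ℕ} (lam : Fin n → ℕ) (hl : ∀ i, lam i ∈ Finset.Icc 1 n) :
    ∀ i ≤ n, ∀ τ : NC (n + 1), PS (wt lam i) τ.val → ∃ c : ℕ → NC (n + 1),
      c 0 = discNC (n + 1) ∧ c i = τ ∧ ∀ k : Fin n, k.val < i → c k ⋖ c (k.val + 1) ∧
        IsStanleyLabel (c k).val (c (k.val + 1)).val (lam k) := by
  intro i
  induction i with
  | zero => 
    intro _ τ h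
    exact ⟨fun _ => τ, eq_disc lam τ h, rfl, fun k hk => absurd hk (by omega)⟩
  | succ i ih =>
    intro hi τ h
    have hli := hl ⟨i, hi⟩
    rw [Finset.mem_Icc] at hli
    have hb : lam ⟨i, hi⟩ = (⟨lam ⟨i, hi⟩ - 1, by omega⟩ : Fin (n + 1)).val + 1 := by
      simp only; omega
    have hw := wt_succ lam ⟨i, hi⟩ _ hb
    simp only at hw
    rw [hw] at h
    obtain ⟨σ, y, hs, hp⟩ := h.down
    obtain ⟨c, hc0, hci, hc⟩ := ih (by omega) ⟨σ, hs.noncrossing τ.prop⟩ hp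
    refine ⟨fun k => if k ≤ i then c k else τ, by simp [hc0], by simp, fun k hk => ?_⟩
    by_cases hki : k.val < i
    · simp only [if_pos hki.le, if_pos (Nat.succ_le_of_lt hki)]
      exact hc k hki
    · have hk' : k = ⟨i, hi⟩ := Fin.ext (by simp only; omega)
      subst hk'
      simp only [le_refl, if_true, if_neg (Nat.not_succ_le_self i), hci]
      refine ⟨Split.covBy hs, ?_⟩
      rw [hb]
      exact hs.label

/-- (Stanley) Attaching to each maximal chain `σ_0 ⋖ σ_1 ⋖ ⋯ ⋖ σ_n` of `NC_{n+1}`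
its sequence of Stanley labels `(λ_1, …, λ_n)` gives a bijection from the maximal
chains of `NC_{n+1}` onto the parking functions of length `n`: every label sequence
is a parking function, and every parking function of length `n` occurs as the label
sequence of exactly one maximal chain. -/
theorem stanley_parking_functions (n : ℕ) :
    (∀ c : ℕ → NC (n + 1), IsMaxChainFun n c → ∀ lam : Fin n → ℕ,
      (∀ i : Fin n, IsStanleyLabel (c i).val (c ((i : ℕ) + 1)).val (lam i)) →
      IsParkingFunction n lam) ∧
    (∀ lam : Fin n → ℕ, IsParkingFunction n lam →
      (∃ c : ℕ → NC (n + 1), IsMaxChainFun n c ∧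
        ∀ i : Fin n, IsStanleyLabel (c i).val (c ((i : ℕ) + 1)).val (lam i)) ∧
      ∀ c c' : ℕ → NC (n + 1), IsMaxChainFun n c → IsMaxChainFun n c' →
        (∀ i : Fin n, IsStanleyLabel (c i).val (c ((i : ℕ) + 1)).val (lam i)) →
        (∀ i : Fin n, IsStanleyLabel (c' i).val (c' ((i : ℕ) + 1)).val (lam i)) →
        ∀ i ≤ n, c i = c' i) := by
  refine ⟨fun c hc lam hl => ?_, fun lam hlam => ⟨?_, fun c c' hc hc' hl hl' => ?_⟩⟩
  · have hr : ∀ i, lam i ∈ Finset.Icc 1 n := by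
      intro i
      obtain ⟨b, y, hb, hs⟩ := label_split (c i).prop (hl i)
      have h1 := hs.1
      have := y.isLt
      rw [Fin.lt_def] at h1
      rw [Finset.mem_Icc]
      omega
    rw [parking_iff lam hr, ← PS_full_iff lam hr, ← hc.2.1]
    exact chain_PS c hc lam hl n le_rfl
  · have hr := hlam.1
    rw [parking_iff lam hr, ← PS_full_iff lam hr] at hlam
    obtain ⟨c, h0, hn, hc⟩ := exists_chain lam hr n le_rfl _ hlam
    exact ⟨c, ⟨h0, hn, fun i hi => (hc ⟨i, hi⟩ hi).1⟩, fun i => (hc i i.isLt).2⟩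
  · have hp := chain_PS c hc lam hl
    have hp' := chain_PS c' hc' lam hl'
    have key : ∀ j ≤ n, c (n - j) = c' (n - j) := by
      intro j
      induction j with
      | zero => intro _; rw [Nat.sub_zero, hc.2.1, hc'.2.1]
      | succ j ih =>
        intro hj
        have e := ih (by omega)
        obtain ⟨i, hi⟩ : ∃ i, i = n - (j + 1) := ⟨_, rfl⟩
        have hi' : n - j = i + 1 := by omega
        rw [← hi]
        rw [hi'] at e
        have hin : i < n := by omega
        obtain ⟨b, y, hb, hs⟩ := label_split (c i).prop (hl ⟨i, hin⟩)
        obtain ⟨b', y', hb', hs'⟩ := label_split (c' i).prop (hl' ⟨i, hin⟩)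
        have hbb : b = b' := Fin.ext (by omega)
        subst hbb
        simp only at hs hs'
        rw [← e] at hs'
        exact Subtype.ext (hs.unique hs' (hp i hin.le) (hp' i hin.le))
    intro i hi
    have := key (n - i) (by omega)
    rwa [Nat.sub_sub_self hi] at this
end

section
/- The number of maximal chains in the noncrossing partition lattice NC_{n+1} equals (n+1)^{n−1}. -/
set_option linter.unusedVariables false
set_option linter.unnecessarySimpa false
set_option linter.unusedSimpArgs false

namespace NCChain
open Finset

lemma abel_aux (n : ℕ) : ∑ k ∈ range (n + 2), ((n+2).choose (k+1) : ℝ) * (k+1 : ℝ)^k *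
    (-(k+1 : ℝ))^(n+1-k) = 0 := by
  have h := congrFun (fwdDiff_iter_pow_eq_zero_of_lt (R := ℝ) (j := n+1) (n := n+2) (by omega)) 0
  rw [fwdDiff_iter_eq_sum_shift, sum_range_succ'] at h
  simp only [Nat.cast_add, Nat.cast_one, zero_add, nsmul_eq_mul, mul_one, Pi.zero_apply, ne_eq, Nat.add_eq_zero_iff, one_ne_zero, and_false, not_false_eq_true, zero_pow, smul_zero, add_zero, zsmul_eq_mul, zero_smul] at h
  rw [← h]
  apply sum_congr rfl
  intro k hk
  have hk' : k ≤ n + 1 := by simp at hk; omega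
  obtain ⟨j, hj⟩ := Nat.exists_eq_add_of_le hk'
  have e1 : n + 1 - k = j := by omega
  have e2 : n + 2 - (k+1) = j := by omega
  rw [e1, e2, hj, neg_pow, pow_add]
  push_cast
  ring

lemma abel (n : ℕ) : ∀ y : ℝ, ∑ k ∈ range (n + 1), ((n+1).choose (k+1) : ℝ) * (k+1 : ℝ)^k *
    (y + (n - k : ℝ))^(n-k) = (n+1) * (y + n + 1)^n := by
  induction n with
  | zero => intro y; simp
  | succ n ih =>
    set f : ℝ → ℝ := fun y => ∑ k ∈ range (n + 2), ((n+2).choose (k+1) : ℝ) * (k+1 : ℝ)^k *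
      (y + ((n+1 : ℝ) - k : ℝ))^(n+1-k) - (n+2) * (y + (n + 2))^(n+1) with hf
    have hd : ∀ y, HasDerivAt f 0 y := by
      intro y
      have h1 : HasDerivAt f (∑ k ∈ range (n + 2), ((n+2).choose (k+1) : ℝ) * (k+1 : ℝ)^k *
        (((n+1-k : ℕ) : ℝ) * (y + ((n+1 : ℝ) - k : ℝ))^(n+1-k-1) * 1)
          - (n+2) * (((n+1 : ℕ) : ℝ) * (y + (n + 2))^(n+1-1) * 1)) y := by
        apply HasDerivAt.sub
        · apply HasDerivAt.fun_sum
          intro k hk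
          apply HasDerivAt.const_mul
          apply HasDerivAt.fun_pow
          exact (hasDerivAt_id y).add_const _
        · apply HasDerivAt.const_mul
          apply HasDerivAt.fun_pow
          exact (hasDerivAt_id y).add_const _
      convert h1 using 1
      rw [sum_range_succ]
      have h2 := ih (y+1)
      have : ∀ k ∈ range (n+1), ((n+2).choose (k+1) : ℝ) * (k+1 : ℝ)^k *
        (((n+1-k : ℕ) : ℝ) * (y + ((n+1 : ℝ) - k : ℝ))^(n+1-k-1) * 1) =
          (n+2) * (((n+1).choose (k+1) : ℝ) * (k+1 : ℝ)^k * ((y+1) + (n - k : ℝ))^(n-k)) := by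
        intro k hk
        have h3 := Nat.choose_mul_succ_eq (n+1) (k+1)
        have e : n + 1 + 1 - (k+1) = n + 1 - k := by omega
        rw [e] at h3
        have h4 : ((n+1).choose (k+1) : ℝ) * (n+2) = ((n+2).choose (k+1) : ℝ) * ((n+1-k : ℕ) : ℝ) := by
          have := congrArg (Nat.cast (R := ℝ)) h3
          push_cast at this ⊢
          linarith
        have e2 : n + 1 - k - 1 = n - k := by omega
        rw [e2]
        have e3 : y + ((n+1 : ℝ) - k : ℝ) = (y+1) + (n - k : ℝ) := by ring
        rw [e3]
        linear_combination (-(k+1 : ℝ)^k * (y + 1 + (n - k : ℝ)) ^ (n - k)) * h4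
      rw [sum_congr rfl this, ← mul_sum, h2]
      simp
      ring
    have hc : ∀ y, f y = f (-(n+2)) := by
      intro y
      exact is_const_of_deriv_eq_zero (fun y => (hd y).differentiableAt) (fun y => (hd y).deriv) _ _
    have h0 : f (-(n+2)) = 0 := by
      simp only [hf]
      rw [neg_add_cancel, zero_pow (by omega), mul_zero, sub_zero, ← abel_aux n]
      apply sum_congr rfl
      intro k hk
      congr 2
      ring
    intro y
    have := (hc y).trans h0
    simp only [hf, sub_eq_zero] at this
    push_cast
    rw [add_assoc y, add_assoc (n:ℝ), one_add_one_eq_two, ← this]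

/-- block weight -/
noncomputable def F (b : ℕ) : ℝ := (b : ℝ)^(b-1) / (b.factorial : ℝ)

lemma F_conv (m : ℕ) : ∑ k ∈ range m, (m - k : ℝ) * (F (k+1) * F (m - k)) = m * F (m+1) := by
  have h := abel m 0
  rw [sum_range_succ] at h
  simp at h
  have : ∀ k ∈ range m, (m - k : ℝ) * (F (k+1) * F (m - k)) =
      (((m+1).choose (k+1) : ℝ) * (k+1 : ℝ)^k * (m - k : ℝ)^(m-k)) / ((m+1).factorial : ℝ) := by
    intro k hk
    have hk : k < m := by simpa using hk
    obtain ⟨j, rfl⟩ := Nat.exists_eq_add_of_lt hk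
    have e : k + j + 1 - k = j + 1 := by omega
    have h5 : (((k+j+1+1).choose (k+1) : ℕ) : ℝ) = ((k+j+1+1).factorial : ℝ) / ((k+1).factorial * (j+1).factorial) := by
      rw [Nat.cast_choose ℝ (by omega)]
      congr 4
      omega
    rw [h5, e]
    have e2 : ((k + j + 1 : ℕ) : ℝ) - k = j + 1 := by push_cast; ring
    rw [e2]
    simp only [F]
    have := Nat.factorial_ne_zero (k+j+1+1)
    have := Nat.factorial_ne_zero (k+1)
    have := Nat.factorial_ne_zero (j+1)
    push_cast
    field_simp
    ring
  rw [sum_congr rfl this, ← sum_div, eq_sub_of_add_eq h]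
  simp only [F, Nat.add_sub_cancel]
  push_cast
  ring

lemma sum_lt_range (G : ℕ → ℝ) (b : ℕ) : ∑ i ∈ range b, ∑ j ∈ range b, (if i < j then G (j - i) else 0)
    = ∑ k ∈ range (b-1), (b - 1 - k : ℝ) * G (k+1) := by
  induction b with
  | zero => simp
  | succ b ih =>
    rw [sum_range_succ]
    have h1 : ∑ j ∈ range (b+1), (if b < j then G (j - b) else 0) = 0 := by
      apply sum_eq_zero
      intro j hj
      simp at hj
      rw [if_neg (by omega)]
    have h2 : ∑ i ∈ range b, ∑ j ∈ range (b+1), (if i < j then G (j - i) else 0) =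
      ∑ i ∈ range b, ∑ j ∈ range b, (if i < j then G (j - i) else 0) + ∑ i ∈ range b, G (i + 1) := by
      rw [← sum_range_reflect (fun i => G (i+1)), ← sum_add_distrib]
      apply sum_congr rfl
      intro i hi
      simp at hi
      rw [sum_range_succ, if_pos hi]
      congr 2
      omega
    rw [h1, h2, ih, add_zero]
    cases b with
    | zero => simp
    | succ b =>
      simp only [Nat.add_sub_cancel]
      have : ∑ k ∈ range b, ((b + 1 : ℕ) - 1 - k : ℝ) * G (k+1) = ∑ k ∈ range (b+1), ((b + 1 : ℕ) - 1 - k : ℝ) * G (k+1) := by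
        rw [sum_range_succ]; simp
      rw [this, ← sum_add_distrib]
      apply sum_congr rfl
      intro k hk
      push_cast
      ring

lemma sum_pairs {α : Type*} [LinearOrder α] (B : Finset α) (hB : B.Nonempty) :
    ∑ x ∈ B, ∑ y ∈ B, (if x < y then F (#{z ∈ B | x ≤ z ∧ z < y}) * F (#B - #{z ∈ B | x ≤ z ∧ z < y}) else 0)
      = (#B - 1 : ℝ) * F (#B) := by
  obtain ⟨m, hm⟩ : ∃ m, #B = m + 1 := Nat.exists_eq_succ_of_ne_zero (by simpa using hB.ne_empty)
  set e := B.orderEmbOfFin hm with he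
  have hs : ∀ f : α → ℝ, ∑ x ∈ B, f x = ∑ i : Fin (m+1), f (e i) := by
    intro f
    conv_lhs => rw [← map_orderEmbOfFin_univ B hm]
    rw [sum_map]; rfl
  have hc : ∀ i j : Fin (m+1), #{z ∈ B | e i ≤ z ∧ z < e j} = (j : ℕ) - i := by
    intro i j
    rw [← Fin.card_Ico, ← card_map e.toEmbedding]
    congr 1
    ext z
    simp only [mem_filter, mem_map, mem_Ico]
    constructor
    · rintro ⟨hz, h1, h2⟩
      rw [← mem_coe, ← range_orderEmbOfFin B hm] at hz
      obtain ⟨k, rfl⟩ := hz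
      exact ⟨k, ⟨e.le_iff_le.1 h1, e.lt_iff_lt.1 h2⟩, rfl⟩
    · rintro ⟨k, ⟨h1, h2⟩, rfl⟩
      exact ⟨orderEmbOfFin_mem B hm k, e.le_iff_le.2 h1, e.lt_iff_lt.2 h2⟩
  simp only [hs, hc, e.lt_iff_lt, hm]
  have := sum_lt_range (fun k => F k * F (m + 1 - k)) (m+1)
  rw [sum_range] at this
  simp only [sum_range (n := m+1)] at this
  simp only [Fin.lt_def]
  rw [this]
  have := F_conv m
  push_cast
  simp only [add_sub_cancel_right]
  exact this

section chains
variable {α : Type*} [PartialOrder α]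

/-- maximal chains of the principal ideal of `a` -/
def MC (a : α) : Set (Set α) :=
  {C | (∀ x ∈ C, x ≤ a) ∧ IsChain (· ≤ ·) C ∧ ∀ x, x ≤ a → (∀ y ∈ C, x ≤ y ∨ y ≤ x) → x ∈ C}

lemma MC_self_mem {a : α} {C : Set α} (h : C ∈ MC a) : a ∈ C :=
  h.2.2 a le_rfl (fun y hy => Or.inr (h.1 y hy))

lemma isMaxChain_iff (a : α) (ha : ∀ x, x ≤ a) (C : Set α) :
    IsMaxChain (· ≤ ·) C ↔ C ∈ MC a := by
  constructor
  · intro h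
    refine ⟨fun x _ => ha x, h.1, fun x _ hx => ?_⟩
    have h1 : IsChain (· ≤ ·) (insert x C) := h.1.insert (fun b hb _ => hx b hb)
    have := h.2 h1 (Set.subset_insert x C)
    rw [this]; exact Set.mem_insert x C
  · rintro ⟨-, h1, h2⟩
    refine ⟨h1, fun D hD hCD => Set.Subset.antisymm hCD ?_⟩
    intro x hx
    exact h2 x (ha x) (fun y hy => hD.total hx (hCD hy))

lemma MC_insert {a b : α} (hab : b ⋖ a) {C : Set α} (h : C ∈ MC b) : insert a C ∈ MC a := by
  refine ⟨?_, ?_, ?_⟩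
  · rintro x (rfl | hx)
    · exact le_rfl
    · exact (h.1 x hx).trans hab.le
  · exact h.2.1.insert (fun c hc _ => Or.inr ((h.1 c hc).trans hab.le))
  · intro x hx hy
    rcases eq_or_lt_of_le hx with rfl | hlt
    · exact Set.mem_insert _ _
    · right
      have hb := MC_self_mem h
      rcases hy b (Set.mem_insert_of_mem _ hb) with h1 | h1
      · exact h.2.2 x h1 (fun y hy' => hy y (Set.mem_insert_of_mem _ hy'))
      · rcases eq_or_lt_of_le h1 with rfl | h2
        · exact hb
        · exact absurd hlt (hab.2 h2)

lemma MC_not_mem {a b : α} (hab : b ⋖ a) {C : Set α} (h : C ∈ MC b) : a ∉ C :=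
  fun ha => absurd (h.1 a ha) (not_le_of_gt hab.lt)

lemma MC_remove [Finite α] {a bot : α} (hbot : ∀ x, bot ≤ x) (ha : a ≠ bot) {C : Set α}
    (h : C ∈ MC a) : ∃ b, b ⋖ a ∧ C \ {a} ∈ MC b := by
  have hb : bot ∈ C := h.2.2 bot (hbot a) (fun y _ => Or.inl (hbot y))
  have hfin : (C \ {a}).Finite := Set.toFinite _
  obtain ⟨b, hbm⟩ := hfin.exists_maximal ⟨bot, hb, fun h' => ha (by simpa using h'.symm)⟩
  have hmax : ∀ c ∈ C \ {a}, c ≤ b := by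
    intro c hc
    rcases h.2.1.total hc.1 hbm.1.1 with h1 | h1
    · exact h1
    · exact hbm.2 hc h1
  have hba : b < a := lt_of_le_of_ne (h.1 b hbm.1.1) hbm.1.2
  refine ⟨b, ⟨hba, ?_⟩, hmax, h.2.1.mono Set.sdiff_subset, ?_⟩
  · intro x hx hxa
    have : x ∈ C := h.2.2 x hxa.le (fun y hy => by
      by_cases e : y = a
      · subst e; exact Or.inl hxa.le
      · exact Or.inr ((hmax y ⟨hy, e⟩).trans hx.le))
    exact absurd (hmax x ⟨this, hxa.ne⟩) (not_le_of_gt hx)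
  · intro x hx hy
    refine ⟨h.2.2 x (hx.trans hba.le) (fun y hy' => ?_), (hx.trans_lt hba).ne⟩
    by_cases e : y = a
    · subst e; exact Or.inl (hx.trans hba.le)
    · exact hy y ⟨hy', e⟩

open Classical in
/-- number of maximal chains below `a` -/
noncomputable def cc [Fintype α] (a : α) : ℕ := #{C : Set α | C ∈ MC a}

open Classical in
lemma cc_rec [Fintype α] {a bot : α} (hbot : ∀ x, bot ≤ x) (ha : a ≠ bot) :
    cc a = ∑ b with b ⋖ a, cc b := by
  have key : ({C : Set α | C ∈ MC a} : Finset (Set α)) =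
      ({b : α | b ⋖ a} : Finset α).biUnion
        (fun b => ({C : Set α | C ∈ MC b} : Finset (Set α)).image (fun C => insert a C)) := by
    ext C
    simp only [mem_filter, mem_univ, true_and, mem_biUnion, mem_image]
    constructor
    · intro h
      obtain ⟨b, hb, hC⟩ := MC_remove hbot ha h
      exact ⟨b, hb, _, hC, by simpa using MC_self_mem h⟩
    · rintro ⟨b, hb, D, hD, rfl⟩
      exact MC_insert hb hD
  have inj : ∀ b b' (C C' : Set α), b ⋖ a → b' ⋖ a → C ∈ MC b → C' ∈ MC b' → insert a C = insert a C' → C = C' := by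
    intro b b' C C' hb hb' hC hC' e
    rw [← Set.insert_sdiff_self_of_notMem (MC_not_mem hb hC), e, Set.insert_sdiff_self_of_notMem (MC_not_mem hb' hC')]
  unfold cc
  rw [key, card_biUnion]
  · apply sum_congr rfl
    intro b hb
    apply card_image_of_injOn
    intro C hC C' hC' e
    simp at hC hC' hb
    exact inj b b C C' hb hb hC hC' e
  · intro b hb b' hb' hne
    show Disjoint _ _
    rw [disjoint_left]
    intro D hD hD'
    simp at hD hD' hb hb'
    obtain ⟨C, hC, rfl⟩ := hD
    obtain ⟨C', hC', e⟩ := hD'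
    have := inj _ _ _ _ hb' hb hC' hC e
    subst this
    exact hne (le_antisymm (hC'.1 b (MC_self_mem hC)) (hC.1 b' (MC_self_mem hC')))

lemma cc_bot [Fintype α] {bot : α} (hbot : ∀ x, bot ≤ x) : cc bot = 1 := by
  classical
  unfold cc
  rw [card_eq_one]
  refine ⟨{bot}, ?_⟩
  ext C
  simp only [mem_filter, mem_univ, true_and, mem_singleton]
  constructor
  · intro h
    ext x
    simp only [Set.mem_singleton_iff]
    constructor
    · intro hx; exact le_antisymm (h.1 x hx) (hbot x)
    · rintro rfl; exact MC_self_mem h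
  · rintro rfl
    refine ⟨by simp, IsChain.singleton, ?_⟩
    intro x hx _
    exact le_antisymm hx (hbot x)
end chains

/-- split a block by the interval `[x, y)` -/
def split {n : ℕ} (π : Setoid (Fin n)) (x y : Fin n) : Setoid (Fin n) where
  r u v := π u v ∧ (π u x → ((x ≤ u ∧ u < y) ↔ (x ≤ v ∧ v < y)))
  iseqv :=
    { refl := fun u => ⟨π.refl u, fun _ => Iff.rfl⟩
      symm := fun {u v} h => ⟨π.symm h.1, fun hv => (h.2 (π.trans h.1 hv)).symm⟩
      trans := fun {u v w} h h' => ⟨π.trans h.1 h'.1, fun hu =>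
        (h.2 hu).trans (h'.2 (π.trans (π.symm h.1) hu))⟩ }

lemma split_apply {n : ℕ} (π : Setoid (Fin n)) (x y u v : Fin n) :
    split π x y u v ↔ π u v ∧ (π u x → ((x ≤ u ∧ u < y) ↔ (x ≤ v ∧ v < y))) := Iff.rfl

lemma split_nc {n : ℕ} {π : Setoid (Fin n)} (h : IsNoncrossing π) (x y : Fin n) :
    IsNoncrossing (split π x y) := by
  intro a b c d hab hbc hcd hac hbd
  rw [split_apply] at *
  have hp := h a b c d hab hbc hcd hac.1 hbd.1
  refine ⟨hp, fun hax => ?_⟩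
  have h1 := hac.2 hax
  have h2 := hbd.2 (π.trans (π.symm hp) hax)
  omega

lemma split_le {n : ℕ} (π : Setoid (Fin n)) (x y : Fin n) : split π x y ≤ π := fun _ _ h => h.1

lemma split_not {n : ℕ} (π : Setoid (Fin n)) {x y : Fin n} (hxy : x < y) :
    ¬ split π x y x y := by
  rw [split_apply]
  rintro ⟨-, h⟩
  have := h (π.refl x)
  omega

lemma split_lt {n : ℕ} (π : Setoid (Fin n)) {x y : Fin n} (hxy : x < y) (h : π x y) :
    split π x y < π := by
  refine lt_of_le_of_ne (split_le π x y) (fun e => split_not π hxy ?_)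
  rw [e]; exact h

lemma split_inj {n : ℕ} {π : Setoid (Fin n)} {x y x' y' : Fin n} (hxy : x < y) (h : π x y)
    (hxy' : x' < y') (h' : π x' y') (hle : split π x y ≤ split π x' y') : x = x' ∧ y = y' := by
  have hB : π x' x := by
    by_contra hn
    have : split π x y x' y' := ⟨h', fun hh => absurd hh hn⟩
    exact split_not π hxy' (hle this)
  have hB' := π.symm hB
  have L : ∀ u v, π u x → π v x → ((x ≤ u ∧ u < y) ↔ (x ≤ v ∧ v < y)) →
      ((x' ≤ u ∧ u < y') ↔ (x' ≤ v ∧ v < y')) := by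
    intro u v hu hv e
    have : split π x y u v := ⟨π.trans hu (π.symm hv), fun _ => e⟩
    exact (hle this).2 (π.trans hu hB')
  have hx := π.refl x
  have hy := π.symm h
  have hy' := π.trans (π.symm h') hB
  have a1 := L x x' hx hB
  have a2 := L y y' hy hy'
  have a3 := L x' y hB hy
  have a4 := L x' y' hB hy'
  have a5 := L x y' hx hy'
  have a6 := L x y hx hy
  omega

lemma exists_split {n : ℕ} {π τ : Setoid (Fin n)} (hτ : IsNoncrossing τ) (hlt : τ < π) :
    ∃ x y, x < y ∧ π x y ∧ τ ≤ split π x y := by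
  classical
  have hle : ∀ u v, τ u v → π u v := fun u v h => hlt.le h
  obtain ⟨u, w, huw, hw, hm⟩ : ∃ u w, π u w ∧ (∀ z, τ u z → z < w) ∧ True := by
    obtain ⟨u, v, huv, hn⟩ : ∃ u v, π u v ∧ ¬ τ u v := by
      by_contra hc
      push Not at hc
      exact absurd (show π ≤ τ from fun u v h => hc u v h) (not_le_of_gt hlt)
    obtain ⟨M, hM, hMm⟩ := (univ.filter (fun z => π u z)).exists_max_image id ⟨u, by simpa using π.refl u⟩
    simp only [mem_filter, mem_univ, true_and, id] at hM hMm
    have aux : ∀ t, π u t → ¬ τ t M → ∃ u w, π u w ∧ (∀ z, τ u z → z < w) ∧ True := by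
      intro t ht htM
      refine ⟨t, M, π.trans (π.symm ht) hM, fun z hz => ?_, trivial⟩
      refine lt_of_le_of_ne (hMm z (π.trans ht (hle _ _ hz))) ?_
      rintro rfl; exact htM hz
    by_cases h1 : τ u M
    · exact aux v huv (fun h2 => hn (τ.trans h1 (τ.symm h2)))
    · exact aux u (π.refl u) h1
  obtain ⟨m, hm, hmm⟩ := (univ.filter (fun z => τ u z)).exists_max_image id ⟨u, by simpa using τ.refl u⟩
  obtain ⟨x, hx, hxm⟩ := (univ.filter (fun z => τ u z)).exists_min_image id ⟨u, by simpa using τ.refl u⟩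
  simp only [mem_filter, mem_univ, true_and, id] at hm hmm hx hxm
  obtain ⟨y, hy, hym⟩ := (univ.filter (fun z => π u z ∧ m < z)).exists_min_image id
    ⟨w, by simpa using ⟨huw, hw m hm⟩⟩
  simp only [mem_filter, mem_univ, true_and, id] at hy hym
  have hxm' : x ≤ m := hxm m hm
  have key : ∀ a b, τ a b → π a x → x ≤ a → a < y → x ≤ b ∧ b < y := by
    intro a b hab hax hxa hay
    have hua : π u a := π.trans (hle _ _ hx) (π.symm hax)
    have hub : π u b := π.trans hua (hle _ _ hab)
    have ham : a ≤ m := by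
      by_contra hc
      exact absurd (hym a ⟨hua, not_le.1 hc⟩) (not_le.2 hay)
    by_cases hua' : τ u a
    · have hb' := τ.trans hua' hab
      exact ⟨hxm b hb', (hmm b hb').trans_lt hy.2⟩
    · have hxa' : x < a := lt_of_le_of_ne hxa (by rintro rfl; exact hua' hx)
      have ham' : a < m := lt_of_le_of_ne ham (by rintro rfl; exact hua' hm)
      have hxm2 : τ x m := τ.trans (τ.symm hx) hm
      constructor
      · by_contra hc
        have := hτ b x a m (not_le.1 hc) hxa' ham' (τ.symm hab) hxm2
        exact hua' (τ.trans hx (τ.trans (τ.symm this) (τ.symm hab)))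
      · by_contra hc
        have := hτ x a m b hxa' ham' (hy.2.trans_le (not_lt.1 hc)) hxm2 hab
        exact hua' (τ.trans hx this)
  refine ⟨x, y, hxm'.trans_lt hy.2, π.trans (π.symm (hle _ _ hx)) hy.1, ?_⟩
  intro a b hab
  refine ⟨hle _ _ hab, fun hax => ⟨fun h => key a b hab hax h.1 h.2, fun h => ?_⟩⟩
  exact key b a (τ.symm hab) (π.trans (π.symm (hle _ _ hab)) hax) h.1 h.2

lemma cov_iff {n : ℕ} (π σ : NC n) : σ ⋖ π ↔ ∃ x y, x < y ∧ π.1 x y ∧ σ.1 = split π.1 x y := by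
  constructor
  · intro h
    obtain ⟨x, y, hxy, hp, hle⟩ := exists_split σ.2 (show σ.1 < π.1 from h.1)
    refine ⟨x, y, hxy, hp, ?_⟩
    by_contra hne
    have h1 : σ < (⟨split π.1 x y, split_nc π.2 x y⟩ : NC n) := lt_of_le_of_ne hle
      (fun e => hne (congrArg Subtype.val e))
    exact h.2 h1 (split_lt π.1 hxy hp)
  · rintro ⟨x, y, hxy, hp, e⟩
    refine ⟨?_, ?_⟩
    · show σ.1 < π.1
      rw [e]; exact split_lt π.1 hxy hp
    · intro τ h1 h2
      have h1 : σ.1 < τ.1 := h1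
      obtain ⟨x', y', hxy', hp', hle⟩ := exists_split τ.2 (show τ.1 < π.1 from h2)
      obtain ⟨rfl, rfl⟩ := split_inj hxy hp hxy' hp' (e ▸ (h1.le.trans hle))
      rw [← e] at hle
      exact absurd hle (not_le_of_gt h1)

open Classical in
/-- block of `x` -/
noncomputable def cls {n : ℕ} (π : Setoid (Fin n)) (x : Fin n) : Finset (Fin n) := {z | π x z}

lemma mem_cls {n : ℕ} {π : Setoid (Fin n)} {x z : Fin n} : z ∈ cls π x ↔ π x z := by
  classical
  simp [cls]

lemma cls_eq_iff {n : ℕ} {π : Setoid (Fin n)} {x z : Fin n} : cls π x = cls π z ↔ π x z := by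
  constructor
  · intro h
    rw [← mem_cls, h, mem_cls]
  · intro h
    ext w
    rw [mem_cls, mem_cls]
    exact ⟨fun h' => π.trans (π.symm h) h', fun h' => π.trans h h'⟩

/-- the set of blocks -/
noncomputable def P {n : ℕ} (π : Setoid (Fin n)) : Finset (Finset (Fin n)) := univ.image (cls π)

lemma cls_mem_P {n : ℕ} (π : Setoid (Fin n)) (x : Fin n) : cls π x ∈ P π :=
  mem_image_of_mem _ (mem_univ x)

lemma mem_of_mem_P {n : ℕ} {π : Setoid (Fin n)} {B : Finset (Fin n)} (hB : B ∈ P π) (x : Fin n) :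
    cls π x = B ↔ x ∈ B := by
  simp only [P, mem_image, mem_univ, true_and] at hB
  obtain ⟨u, rfl⟩ := hB
  rw [cls_eq_iff, mem_cls]
  exact ⟨fun h => π.symm h, fun h => π.symm h⟩

/-- the part `B ∩ [x,y)` -/
noncomputable def part {n : ℕ} (π : Setoid (Fin n)) (x y : Fin n) : Finset (Fin n) :=
  {z ∈ cls π x | x ≤ z ∧ z < y}

lemma part_subset {n : ℕ} (π : Setoid (Fin n)) (x y : Fin n) : part π x y ⊆ cls π x :=
  filter_subset _ _

lemma left_mem_part {n : ℕ} (π : Setoid (Fin n)) {x y : Fin n} (hxy : x < y) : x ∈ part π x y := by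
  simp [part, mem_cls, hxy, π.refl x]

lemma right_mem {n : ℕ} (π : Setoid (Fin n)) {x y : Fin n} (h : π x y) :
    y ∈ cls π x \ part π x y := by
  simp [part, mem_cls, h]

lemma cls_split {n : ℕ} (π : Setoid (Fin n)) (x y u : Fin n) :
    cls (split π x y) u = if u ∈ cls π x then (if u ∈ part π x y then part π x y
      else cls π x \ part π x y) else cls π u := by
  ext z
  rw [mem_cls, split_apply]
  by_cases h : π x u
  · rw [if_pos (mem_cls.2 h)]
    have e : π u z ↔ π x z := ⟨fun h' => π.trans h h', fun h' => π.trans (π.symm h) h'⟩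
    have e2 : π u x := π.symm h
    by_cases hu : x ≤ u ∧ u < y
    · rw [if_pos (by simp [part, mem_cls, h, hu])]
      simp only [part, mem_filter, mem_cls]
      tauto
    · rw [if_neg (by simp only [part, mem_filter, mem_cls]; tauto)]
      simp only [part, mem_sdiff, mem_filter, mem_cls]
      tauto
  · rw [if_neg (by rwa [mem_cls]), mem_cls]
    have : ¬ π u x := fun h' => h (π.symm h')
    tauto

lemma P_split {n : ℕ} (π : Setoid (Fin n)) {x y : Fin n} (hxy : x < y) (h : π x y) :
    P (split π x y) = insert (part π x y) (insert (cls π x \ part π x y) ((P π).erase (cls π x))) := by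
  have hx := left_mem_part π hxy
  have hy := right_mem π h
  ext B
  simp only [mem_insert, mem_erase]
  constructor
  · intro hB
    simp only [P, mem_image, mem_univ, true_and] at hB
    obtain ⟨u, rfl⟩ := hB
    rw [cls_split]
    split_ifs with h1 h2
    · exact Or.inl rfl
    · exact Or.inr (Or.inl rfl)
    · refine Or.inr (Or.inr ⟨fun e => h1 ?_, cls_mem_P _ _⟩)
      rw [← e, mem_cls]
  · rintro (rfl | rfl | ⟨h1, h2⟩)
    · have := cls_mem_P (split π x y) x
      rwa [cls_split, if_pos (part_subset _ _ _ hx), if_pos hx] at this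
    · have := cls_mem_P (split π x y) y
      rwa [cls_split, if_pos (mem_sdiff.1 hy).1, if_neg (mem_sdiff.1 hy).2] at this
    · simp only [P, mem_image, mem_univ, true_and] at h2
      obtain ⟨u, rfl⟩ := h2
      have := cls_mem_P (split π x y) u
      rwa [cls_split, if_neg] at this
      rw [mem_cls]
      intro h'
      exact h1 (cls_eq_iff.2 (π.symm h'))

lemma part_notMem {n : ℕ} (π : Setoid (Fin n)) {x y : Fin n} (hxy : x < y) :
    part π x y ∉ insert (cls π x \ part π x y) ((P π).erase (cls π x)) := by
  have hx := left_mem_part π hxy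
  simp only [mem_insert, mem_erase, not_or, not_and]
  constructor
  · intro e
    have h2 := hx
    rw [e] at h2
    exact (mem_sdiff.1 h2).2 hx
  · intro hne hP
    exact hne ((mem_of_mem_P hP x).2 hx).symm

lemma sdiff_notMem {n : ℕ} (π : Setoid (Fin n)) {x y : Fin n} (h : π x y) :
    cls π x \ part π x y ∉ (P π).erase (cls π x) := by
  have hy := right_mem π h
  simp only [mem_erase, not_and]
  intro hne hP
  exact hne (((mem_of_mem_P hP y).2 hy).symm.trans (cls_eq_iff.2 (π.symm h)))

/-- weight of a partition -/
noncomputable def W {n : ℕ} (π : Setoid (Fin n)) : ℝ := ∏ B ∈ P π, F (#B)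

/-- rank of a partition -/
noncomputable def rk {n : ℕ} (π : Setoid (Fin n)) : ℕ := ∑ B ∈ P π, (#B - 1)

lemma W_split {n : ℕ} (π : Setoid (Fin n)) {x y : Fin n} (hxy : x < y) (h : π x y) :
    W (split π x y) = F (#(part π x y)) * F (#(cls π x) - #(part π x y)) *
      ∏ B ∈ (P π).erase (cls π x), F (#B) := by
  rw [W, P_split π hxy h, prod_insert (part_notMem π hxy), prod_insert (sdiff_notMem π h),
    card_sdiff_of_subset (part_subset π x y), mul_assoc]

lemma rk_split {n : ℕ} (π : Setoid (Fin n)) {x y : Fin n} (hxy : x < y) (h : π x y) :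
    rk (split π x y) + 1 = rk π := by
  have h1 : 0 < #(part π x y) := card_pos.2 ⟨x, left_mem_part π hxy⟩
  have h2 : 0 < #(cls π x \ part π x y) := card_pos.2 ⟨y, right_mem π h⟩
  have h3 := card_sdiff_of_subset (part_subset π x y)
  have h4 := add_sum_erase (P π) (fun B => #B - 1) (cls_mem_P π x)
  rw [rk, P_split π hxy h, sum_insert (part_notMem π hxy), sum_insert (sdiff_notMem π h), rk]
  omega

open Classical in
lemma sum_split {n : ℕ} (π : Setoid (Fin n)) :
    ∑ x, ∑ y, (if x < y ∧ π x y then W (split π x y) else 0) = rk π * W π := by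
  rw [← sum_fiberwise_of_maps_to (s := univ) (t := P π) (g := cls π) (fun x _ => cls_mem_P π x),
    rk, Nat.cast_sum, sum_mul]
  apply sum_congr rfl
  intro B hB
  have hne : B.Nonempty := by
    simp only [P, mem_image, mem_univ, true_and] at hB
    obtain ⟨u, rfl⟩ := hB
    exact ⟨u, mem_cls.2 (π.refl u)⟩
  have e1 : ({x | cls π x = B} : Finset (Fin n)) = B := by
    ext x; simp [mem_of_mem_P hB]
  rw [e1, Nat.cast_sub (card_pos.2 hne), Nat.cast_one, W, ← mul_prod_erase _ _ hB, ← mul_assoc,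
    ← sum_pairs B hne, sum_mul]
  apply sum_congr rfl
  intro x hx
  have hc := (mem_of_mem_P hB x).2 hx
  rw [sum_mul, ← sum_subset (subset_univ B)]
  · apply sum_congr rfl
    intro y hy
    have hp : π x y := by rw [← mem_cls, hc]; exact hy
    by_cases hxy : x < y
    · rw [if_pos ⟨hxy, hp⟩, if_pos hxy, W_split π hxy hp]
      simp only [part, hc]
    · rw [if_neg (fun h => hxy h.1), if_neg hxy, zero_mul]
  · intro y _ hy
    rw [if_neg]
    rintro ⟨_, h⟩
    rw [← mem_cls, hc] at h
    exact hy h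

instance instFiniteNC {n : ℕ} : Finite (NC n) := by
  have : Finite (Setoid (Fin n)) :=
    Finite.of_injective (fun (σ : Setoid (Fin n)) (a b : Fin n) => σ a b)
      (fun σ τ h => Setoid.ext (fun a b => iff_of_eq (congrFun (congrFun h a) b)))
  exact Subtype.finite

noncomputable instance instFintypeNC {n : ℕ} : Fintype (NC n) := Fintype.ofFinite _

open Classical in
lemma sum_cov {n : ℕ} (π : NC n) : ∑ σ with σ ⋖ π, W σ.1 = rk π.1 * W π.1 := by
  rw [← sum_split, ← sum_product', ← sum_filter, eq_comm]
  apply sum_bij (fun (p : Fin n × Fin n) _ => (⟨split π.1 p.1 p.2, split_nc π.2 _ _⟩ : NC n))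
  · intro p hp
    simp only [mem_filter, mem_product, mem_univ, true_and] at hp ⊢
    exact (cov_iff _ _).2 ⟨p.1, p.2, hp.1, hp.2, rfl⟩
  · intro p hp q hq e
    simp only [mem_filter, mem_product, mem_univ, true_and] at hp hq
    have := split_inj hp.1 hp.2 hq.1 hq.2 (congrArg Subtype.val e).le
    exact Prod.ext this.1 this.2
  · intro σ hσ
    simp only [mem_filter, mem_univ, true_and] at hσ
    obtain ⟨x, y, h1, h2, h3⟩ := (cov_iff _ _).1 hσ
    exact ⟨(x, y), by simp [h1, h2], Subtype.ext h3.symm⟩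
  · intro p hp
    rfl

/-- discrete partition -/
def bt (n : ℕ) : NC n := ⟨⊥, fun a b c d h1 h2 _ h _ => absurd (show a = c from h) (h1.trans h2).ne⟩

lemma bt_le {n : ℕ} (π : NC n) : bt n ≤ π := show (⊥ : Setoid (Fin n)) ≤ π.1 from bot_le

/-- one-block partition -/
def tp (n : ℕ) : NC n := ⟨⊤, fun _ _ _ _ _ _ _ _ _ => trivial⟩

lemma le_tp {n : ℕ} (π : NC n) : π ≤ tp n := show π.1 ≤ (⊤ : Setoid (Fin n)) from le_top

lemma cls_bot {n : ℕ} (x : Fin n) : cls (⊥ : Setoid (Fin n)) x = {x} := by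
  ext z; rw [mem_cls, mem_singleton]
  exact eq_comm

lemma card_bot {n : ℕ} {B : Finset (Fin n)} (hB : B ∈ P (⊥ : Setoid (Fin n))) : #B = 1 := by
  simp only [P, mem_image, mem_univ, true_and] at hB
  obtain ⟨u, rfl⟩ := hB
  rw [cls_bot, card_singleton]

lemma main {n : ℕ} (π : NC n) : (cc π : ℝ) = (rk π.1).factorial * W π.1 := by
  classical
  induction π using WellFoundedLT.induction with
  | ind π ih =>
    by_cases hb : π = bt n
    · rw [hb, cc_bot bt_le]
      have h1 : rk (bt n).1 = 0 := by
        apply sum_eq_zero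
        intro B hB
        simp [card_bot hB]
      have h2 : W (bt n).1 = 1 := by
        apply prod_eq_one
        intro B hB
        rw [card_bot hB]
        simp [F]
      rw [h1, h2]
      simp
    · obtain ⟨x, y, hxy, hp⟩ : ∃ x y, x < y ∧ π.1 x y := by
        obtain ⟨x, y, h1, h2, -⟩ := exists_split (bt n).2
          (show (bt n).1 < π.1 from lt_of_le_of_ne (bt_le π) (fun e => hb (Subtype.ext e.symm)))
        exact ⟨x, y, h1, h2⟩
      have hr := rk_split π.1 hxy hp
      obtain ⟨r, hr⟩ : ∃ r, rk π.1 = r + 1 := ⟨_, hr.symm⟩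
      rw [cc_rec bt_le hb, Nat.cast_sum]
      have : ∀ σ ∈ ({σ | σ ⋖ π} : Finset (NC n)), (cc σ : ℝ) = r.factorial * W σ.1 := by
        intro σ hσ
        simp only [mem_filter, mem_univ, true_and] at hσ
        rw [ih σ hσ.lt]
        obtain ⟨x, y, h1, h2, h3⟩ := (cov_iff _ _).1 hσ
        have := rk_split π.1 h1 h2
        rw [← h3] at this
        have : rk σ.1 = r := by omega
        rw [this]
      rw [sum_congr rfl this, ← mul_sum, sum_cov, hr, Nat.factorial_succ]
      push_cast
      ring

lemma P_top (n : ℕ) : P (⊤ : Setoid (Fin (n+1))) = {univ} := by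
  have h : ∀ x, cls (⊤ : Setoid (Fin (n+1))) x = univ := by
    intro x; ext z; simp [mem_cls]
  ext B
  simp only [P, mem_image, mem_univ, true_and, mem_singleton, h]
  exact ⟨fun ⟨_, h⟩ => h.symm, fun h => ⟨0, h.symm⟩⟩
end NCChain

/-- The number of maximal chains in the noncrossing partition lattice `NC_{n+1}`
equals `(n + 1) ^ (n - 1)`. -/
theorem card_maximal_chains_NC (n : ℕ) :
    Nat.card {C : Set (NC (n + 1)) // IsMaxChain (· ≤ ·) C} = (n + 1) ^ (n - 1) := by
  classical
  have h1 : Nat.card {C : Set (NC (n + 1)) // IsMaxChain (· ≤ ·) C} = NCChain.cc (NCChain.tp (n+1)) := by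
    rw [NCChain.cc, Nat.card_eq_fintype_card, Fintype.card_subtype]
    congr 1
    ext C
    simp only [Finset.mem_filter, Finset.mem_univ, true_and]
    exact NCChain.isMaxChain_iff _ NCChain.le_tp C
  have h2 := NCChain.main (NCChain.tp (n+1))
  rw [NCChain.rk, NCChain.W, show (NCChain.tp (n+1)).1 = ⊤ from rfl, NCChain.P_top,
    Finset.sum_singleton, Finset.prod_singleton, Finset.card_univ, Fintype.card_fin,
    NCChain.F, Nat.factorial_succ] at h2
  rw [h1]
  have h3 : (n.factorial : ℝ) ≠ 0 := by exact_mod_cast Nat.factorial_ne_zero n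
  have h4 : ((n : ℝ) + 1) ≠ 0 := by positivity
  cases n with
  | zero =>
    simp at h2 ⊢
    exact h2
  | succ m =>
    have : (NCChain.cc (NCChain.tp (m+1+1)) : ℝ) = (((m+1+1)^m : ℕ) : ℝ) := by
      rw [h2]
      simp only [Nat.add_sub_cancel]
      push_cast at *
      field_simp
      try ring
    exact_mod_cast this
end
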